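/- Fix an integer C ≥ 1 and real parameters n, N. On the open set U of pairs (s,t) ∈ ℝ² with N − s > 0 and 0 < (n−t)/(N−s) < C, let λ = λ(s,t) be the unique positive solution of λ g′(λ)/g(λ) = (n−t)/(N−s), let G(λ) = λ g″(λ)/g(λ) + g′(λ)/g(λ) − λ (g′(λ)/g(λ))², and let F(s,t) = (n−t)·log λ − (N−s)·log g(λ). Then on U: ∂λ/∂t = −1/((N−s) G(λ)) and ∂λ/∂s = (n−t)/((N−s)² G(λ)); consequently ∂²F/∂t² = 1/((N−s) λ G(λ)), ∂²F/∂s∂t = −(n−t)/((N−s)² λ G(λ)), and ∂²F/∂s² = (n−t)²/((N−s)³ λ G(λ)). -/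

import Mathlib

open Finset
open scoped BigOperators

/-- `g(λ) = ∑_{k=0}^C λ^k / k!`. -/
noncomputable def gfun (C : ℕ) (x : ℝ) : ℝ :=
  ∑ k ∈ Finset.range (C + 1), x ^ k / (Nat.factorial k)

/-- `G(λ) = λ g″(λ)/g(λ) + g′(λ)/g(λ) − λ (g′(λ)/g(λ))²  ( = Var(W(λ))/λ )`. -/
noncomputable def Gfun (C : ℕ) (x : ℝ) : ℝ :=
  x * deriv (deriv (gfun C)) x / gfun C x + deriv (gfun C) x / gfun C x -
    x * (deriv (gfun C) x / gfun C x) ^ 2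

theorem mul_deriv_sum_pow (c : ℕ → ℝ) (m : ℕ) (x : ℝ) :
    x * deriv (fun y : ℝ => ∑ k ∈ Finset.range m, c k * y ^ k) x =
      ∑ k ∈ Finset.range m, (k * c k) * x ^ k := by
  have h : HasDerivAt (fun y : ℝ => ∑ k ∈ Finset.range m, c k * y ^ k)
      (∑ k ∈ Finset.range m, c k * (k * x ^ (k - 1))) x :=
    HasDerivAt.fun_sum fun k _ => (hasDerivAt_pow k x).const_mul (c k)
  rw [h.deriv, Finset.mul_sum]
  refine Finset.sum_congr rfl fun k _ => ?_
  rcases k with _ | k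
  · simp
  · simp only [Nat.add_sub_cancel]
    ring

theorem gfun_eq_sum (C : ℕ) :
    gfun C = fun y : ℝ => ∑ k ∈ Finset.range (C + 1), (1 / (Nat.factorial k : ℝ)) * y ^ k := by
  funext y
  exact Finset.sum_congr rfl fun k _ => by ring

theorem contDiff_gfun (C : ℕ) {r : WithTop ℕ∞} : ContDiff ℝ r (gfun C) := by
  rw [gfun_eq_sum]
  fun_prop

theorem contDiff_deriv_gfun (C : ℕ) : ContDiff ℝ 1 (deriv (gfun C)) :=
  (contDiff_gfun C (r := 1 + 1)).deriv'

theorem gfun_pos (C : ℕ) {x : ℝ} (hx : 0 < x) : 0 < gfun C x :=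
  Finset.sum_pos (fun _ _ => by positivity) ⟨0, by simp⟩

theorem mul_deriv_gfun (C : ℕ) (x : ℝ) :
    x * deriv (gfun C) x =
      ∑ k ∈ Finset.range (C + 1), (k * (1 / (Nat.factorial k : ℝ))) * x ^ k := by
  rw [gfun_eq_sum, mul_deriv_sum_pow]

theorem hasDerivAt_mul_deriv_gfun (C : ℕ) (x : ℝ) :
    HasDerivAt (fun y => y * deriv (gfun C) y)
      (deriv (gfun C) x + x * deriv (deriv (gfun C)) x) x := by
  have h := ((contDiff_deriv_gfun C).differentiable (by norm_num) x).hasDerivAt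
  exact ((hasDerivAt_id x).mul h).congr_deriv (by simp)

theorem second_moment_gfun (C : ℕ) (x : ℝ) :
    x * (deriv (gfun C) x + x * deriv (deriv (gfun C)) x) =
      ∑ k ∈ Finset.range (C + 1), (k * (k * (1 / (Nat.factorial k : ℝ)))) * x ^ k := by
  rw [← (hasDerivAt_mul_deriv_gfun C x).deriv, funext (mul_deriv_gfun C), mul_deriv_sum_pow]

/-- `G` is positive, being a variance divided by `λ`. -/
theorem Gfun_pos {C : ℕ} (hC : 1 ≤ C) {x : ℝ} (hx : 0 < x) : 0 < Gfun C x := by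
  have hg := gfun_pos C hx
  set m := x * deriv (gfun C) x / gfun C x with hm
  have hvar : x * gfun C x * Gfun C x =
      ∑ k ∈ Finset.range (C + 1), (1 / (Nat.factorial k : ℝ)) * x ^ k * (k - m) ^ 2 := by
    have hexp : ∑ k ∈ Finset.range (C + 1), (1 / (Nat.factorial k : ℝ)) * x ^ k * (k - m) ^ 2 =
        x * (deriv (gfun C) x + x * deriv (deriv (gfun C)) x) -
          2 * m * (x * deriv (gfun C) x) + m ^ 2 * gfun C x := by
      rw [second_moment_gfun, mul_deriv_gfun, congrFun (gfun_eq_sum C) x, Finset.mul_sum,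
        Finset.mul_sum, ← Finset.sum_sub_distrib, ← Finset.sum_add_distrib]
      exact Finset.sum_congr rfl fun k _ => by ring
    rw [hexp, hm, Gfun]
    field_simp
    ring
  have hpos : 0 < x * gfun C x * Gfun C x := by
    rw [hvar]
    refine Finset.sum_pos' (fun k _ => by positivity) ?_
    by_cases h0 : m = 0
    · exact ⟨1, by simp; omega, by simp [h0, hx]⟩
    · exact ⟨0, by simp, by simp; positivity⟩
  exact pos_of_mul_pos_right hpos (by positivity)

/-- The mean `λ g′(λ)/g(λ)` of the truncated Poisson law has derivative `G`. -/
theorem hasStrictDerivAt_mean (C : ℕ) {x : ℝ} (hx : 0 < x) :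
    HasStrictDerivAt (fun y => y * deriv (gfun C) y / gfun C y) (Gfun C x) x := by
  have hg := (gfun_pos C hx).ne'
  have hd : HasDerivAt (fun y => y * deriv (gfun C) y / gfun C y) (Gfun C x) x := by
    refine ((hasDerivAt_mul_deriv_gfun C x).div
      ((contDiff_gfun C (r := 1)).differentiable (by norm_num) x).hasDerivAt hg).congr_deriv ?_
    rw [Gfun]
    field_simp
    ring
  have hc : ContDiffAt ℝ 1 (fun y => y * deriv (gfun C) y / gfun C y) x :=
    (contDiff_id.mul (contDiff_deriv_gfun C)).contDiffAt.div (contDiff_gfun C).contDiffAt hg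
  exact hc.hasStrictDerivAt' hd (by norm_num)

theorem injOn_mean {C : ℕ} (hC : 1 ≤ C) :
    Set.InjOn (fun y => y * deriv (gfun C) y / gfun C y) (Set.Ioi 0) := by
  refine (strictMonoOn_of_deriv_pos (convex_Ioi 0) (fun x hx => ?_) fun x hx => ?_).injOn
  · exact (hasStrictDerivAt_mean C hx).hasDerivAt.continuousAt.continuousWithinAt
  · rw [interior_Ioi] at hx
    rw [(hasStrictDerivAt_mean C hx).hasDerivAt.deriv]
    exact Gfun_pos hC hx

/-- Near `λ₀ g′(λ₀)/g(λ₀)`, the solution of `λ g′(λ)/g(λ) = u` depends differentiably on `u`. -/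
theorem exists_local_inverse_mean {C : ℕ} (hC : 1 ≤ C) {x : ℝ} (hx : 0 < x) :
    ∃ φ : ℝ → ℝ, HasDerivAt φ (Gfun C x)⁻¹ (x * deriv (gfun C) x / gfun C x) ∧
      ∀ᶠ u in nhds (x * deriv (gfun C) x / gfun C x),
        ∀ y, 0 < y → y * deriv (gfun C) y / gfun C y = u → y = φ u := by
  have h := hasStrictDerivAt_mean C hx
  have hG := (Gfun_pos hC hx).ne'
  have hφ := (h.to_localInverse hG).hasDerivAt
  have hφx : h.localInverse _ _ _ hG (x * deriv (gfun C) x / gfun C x) = x :=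
    (h.hasStrictFDerivAt_equiv hG).localInverse_apply_image
  refine ⟨_, hφ, ?_⟩
  have hpos := hφ.continuousAt.eventually (p := fun y => 0 < y) (by
    rw [hφx]
    exact lt_mem_nhds hx)
  filter_upwards [hpos, (h.hasStrictFDerivAt_equiv hG).eventually_right_inverse]
    with u hu hr y hy hyu
  exact injOn_mean hC hy hu (hyu.trans hr.symm)

/-- **Lemma (partial derivatives of `λ(s,t)` and second partials of `F`).** On the open
set `U` of pairs `(s,t)` with `N − s > 0` and `0 < (n−t)/(N−s) < C`, with `λ = λ(s,t)` the
unique positive solution of `λ g′(λ)/g(λ) = (n−t)/(N−s)` and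
`F(s,t) = (n−t) log λ − (N−s) log g(λ)`:
`∂λ/∂t = −1/((N−s) G(λ))`, `∂λ/∂s = (n−t)/((N−s)² G(λ))`, and consequently
`∂²F/∂t² = 1/((N−s) λ G(λ))`, `∂²F/∂s∂t = −(n−t)/((N−s)² λ G(λ))`,
`∂²F/∂s² = (n−t)²/((N−s)³ λ G(λ))`. -/
theorem statement11 (C : ℕ) (hC : 1 ≤ C) (n N : ℝ)
    (U : Set (ℝ × ℝ))
    (hU : U = {p : ℝ × ℝ | 0 < N - p.1 ∧ 0 < (n - p.2) / (N - p.1) ∧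
        (n - p.2) / (N - p.1) < C})
    (lam : ℝ → ℝ → ℝ)
    (hlampos : ∀ s t, (s, t) ∈ U → 0 < lam s t)
    (hlam : ∀ s t, (s, t) ∈ U →
      lam s t * deriv (gfun C) (lam s t) / gfun C (lam s t) = (n - t) / (N - s))
    (F : ℝ → ℝ → ℝ)
    (hF : ∀ s t, F s t =
      (n - t) * Real.log (lam s t) - (N - s) * Real.log (gfun C (lam s t))) :
    ∀ s t, (s, t) ∈ U →
      HasDerivAt (fun t' => lam s t') (-1 / ((N - s) * Gfun C (lam s t))) t ∧
      HasDerivAt (fun s' => lam s' t) ((n - t) / ((N - s) ^ 2 * Gfun C (lam s t))) s ∧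
      HasDerivAt (fun t' => deriv (fun t'' => F s t'') t')
        (1 / ((N - s) * lam s t * Gfun C (lam s t))) t ∧
      HasDerivAt (fun s' => deriv (fun t'' => F s' t'') t)
        (-(n - t) / ((N - s) ^ 2 * lam s t * Gfun C (lam s t))) s ∧
      HasDerivAt (fun s' => deriv (fun s'' => F s'' t) s')
        ((n - t) ^ 2 / ((N - s) ^ 3 * lam s t * Gfun C (lam s t))) s := by
  subst hU
  have hratio : ∀ s t, 0 < N - s → ContinuousAt (fun p : ℝ × ℝ => (n - p.2) / (N - p.1)) (s, t) :=
    fun s t h => ContinuousAt.div (by fun_prop) (by fun_prop) h.ne'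
  have hopen : ∀ s t, (s, t) ∈ {p : ℝ × ℝ | 0 < N - p.1 ∧ 0 < (n - p.2) / (N - p.1) ∧
        (n - p.2) / (N - p.1) < C} → ∀ᶠ p in nhds (s, t),
        p ∈ {p : ℝ × ℝ | 0 < N - p.1 ∧ 0 < (n - p.2) / (N - p.1) ∧
        (n - p.2) / (N - p.1) < C} := by
    rintro s t ⟨h1, h2, h3⟩
    have hc : ContinuousAt (fun p : ℝ × ℝ => N - p.1) (s, t) := by fun_prop
    filter_upwards [hc.eventually (lt_mem_nhds h1), (hratio s t h1).eventually (lt_mem_nhds h2),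
      (hratio s t h1).eventually (gt_mem_nhds h3)] with p a b c
    exact ⟨a, b, c⟩
  set U := {p : ℝ × ℝ | 0 < N - p.1 ∧ 0 < (n - p.2) / (N - p.1) ∧
        (n - p.2) / (N - p.1) < C} with hUdef
  have hlineT : ∀ s t : ℝ, Filter.Tendsto (fun t' => (s, t')) (nhds t) (nhds (s, t)) :=
    fun s t => Continuous.tendsto (by fun_prop) t
  have hlineS : ∀ s t : ℝ, Filter.Tendsto (fun s' => (s', t)) (nhds s) (nhds (s, t)) :=
    fun s t => Continuous.tendsto (by fun_prop) s
  have hlamD : ∀ s t, (s, t) ∈ U →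
      HasDerivAt (fun t' => lam s t') (-1 / ((N - s) * Gfun C (lam s t))) t ∧
      HasDerivAt (fun s' => lam s' t) ((n - t) / ((N - s) ^ 2 * Gfun C (lam s t))) s := by
    intro s t hst
    have hN : 0 < N - s := hst.1
    have hG := Gfun_pos hC (hlampos s t hst)
    obtain ⟨φ, hφ, hev⟩ := exists_local_inverse_mean hC (hlampos s t hst)
    rw [hlam s t hst] at hφ hev
    have hlamφ : ∀ᶠ p in nhds (s, t), lam p.1 p.2 = φ ((n - p.2) / (N - p.1)) := by
      filter_upwards [hopen s t hst, (hratio s t hN).eventually hev] with p hp hpu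
      exact hpu _ (hlampos _ _ hp) (hlam _ _ hp)
    constructor
    · have hu : HasDerivAt (fun t' => (n - t') / (N - s)) (-1 / (N - s)) t :=
        ((hasDerivAt_id t).const_sub n).div_const _
      refine ((HasDerivAt.comp t hφ hu).congr_of_eventuallyEq
        ((hlineT s t).eventually hlamφ)).congr_deriv ?_
      field_simp
    · have hu : HasDerivAt (fun s' => (n - t) / (N - s')) ((n - t) / (N - s) ^ 2) s := by
        refine ((hasDerivAt_const s (n - t)).div ((hasDerivAt_id s).const_sub N)
          hN.ne').congr_deriv ?_
        simp
      refine ((HasDerivAt.comp s hφ hu).congr_of_eventuallyEq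
        ((hlineS s t).eventually hlamφ)).congr_deriv ?_
      field_simp
  have hgD : ∀ x, HasDerivAt (gfun C) (deriv (gfun C) x) x := fun x =>
    ((contDiff_gfun C (r := 1)).differentiable (by norm_num) x).hasDerivAt
  have hbal : ∀ s t, (s, t) ∈ U →
      deriv (gfun C) (lam s t) / gfun C (lam s t) = (n - t) / ((N - s) * lam s t) := by
    intro s t hst
    have hl := hlampos s t hst
    rw [mul_comm (N - s), ← div_div, div_right_comm, ← hlam s t hst]
    field_simp
  have hFT : ∀ s t, (s, t) ∈ U → deriv (fun t' => F s t') t = -Real.log (lam s t) := by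
    intro s t hst
    have hN : 0 < N - s := hst.1
    have hl := hlampos s t hst
    have hD := (hlamD s t hst).1
    have hg := gfun_pos C hl
    simp only [hF]
    refine HasDerivAt.deriv (HasDerivAt.congr_deriv
      ((((hasDerivAt_id t).const_sub n).mul (hD.log hl.ne')).sub
        ((((hgD _).comp t hD).log hg.ne').const_mul (N - s))) ?_)
    rw [mul_div_right_comm, Function.comp_apply, hbal s t hst]
    simp only [id]
    field_simp
    ring
  have hFS : ∀ s t, (s, t) ∈ U →
      deriv (fun s' => F s' t) s = Real.log (gfun C (lam s t)) := by
    intro s t hst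
    have hN : 0 < N - s := hst.1
    have hl := hlampos s t hst
    have hD := (hlamD s t hst).2
    have hg := gfun_pos C hl
    simp only [hF]
    refine HasDerivAt.deriv (HasDerivAt.congr_deriv
      (((hD.log hl.ne').const_mul (n - t)).sub
        (((hasDerivAt_id s).const_sub N).mul (((hgD _).comp s hD).log hg.ne'))) ?_)
    rw [mul_div_right_comm, Function.comp_apply, hbal s t hst]
    simp only [id]
    field_simp
    ring
  intro s t hst
  have hN : 0 < N - s := hst.1
  have hl := hlampos s t hst
  have hg := gfun_pos C hl
  have hG := Gfun_pos hC hl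
  obtain ⟨hDT, hDS⟩ := hlamD s t hst
  have hUT := (hlineT s t).eventually (hopen s t hst)
  have hUS := (hlineS s t).eventually (hopen s t hst)
  refine ⟨hDT, hDS, ?_, ?_, ?_⟩
  · refine ((hDT.log hl.ne').neg.congr_of_eventuallyEq
      (hUT.mono fun t' h => hFT s t' h)).congr_deriv ?_
    field_simp
  · refine ((hDS.log hl.ne').neg.congr_of_eventuallyEq
      (hUS.mono fun s' h => hFT s' t h)).congr_deriv ?_
    field_simp
  · refine ((((hgD _).comp s hDS).log hg.ne').congr_of_eventuallyEq
      (hUS.mono fun s' h => hFS s' t h)).congr_deriv ?_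
    rw [mul_div_right_comm, Function.comp_apply, hbal s t hst]
    field_simp
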